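/- Let M be a symmetric real n×n matrix and let 1 ≤ s ≤ n. Let R ⊆ {1,…,n} have cardinality s and maximize ‖M_{S×:}‖_F² over all index sets S of cardinality s, and let C ⊆ {1,…,n} have cardinality s and maximize ‖M_{R×S}‖_F² over all index sets S of cardinality s. Set T := R ∪ C, so |T| ≤ 2s. Then for every index set S of cardinality s, ‖M_{T×T}‖_F² ≥ (s/n) · ‖M_{S×S}‖_F². (That is, this practical algorithm is a head projection for Σ_{(s)} into Σ_{(2s)} with constant c_H = √(s/n).) -/

import Mathlib

open Matrix Finset MeasureTheory
open scoped ENNReal NNReal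

/-- Frobenius norm of a real `n × n` matrix. -/
noncomputable def frobNorm {n : ℕ} (M : Matrix (Fin n) (Fin n) ℝ) : ℝ :=
  Real.sqrt (∑ i, ∑ j, (M i j) ^ 2)

/-- Frobenius inner product `⟨A, B⟩_F = tr(Aᵀ B)`. -/
def frobInner {n : ℕ} (A B : Matrix (Fin n) (Fin n) ℝ) : ℝ :=
  ∑ i, ∑ j, A i j * B i j

/-- Euclidean (ℓ₂) norm on `ℝ^m`. -/
noncomputable def l2norm {m : ℕ} (y : Fin m → ℝ) : ℝ :=
  Real.sqrt (∑ i, (y i) ^ 2)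

/-- ℓ₁ norm on `ℝ^m`. -/
def l1norm {m : ℕ} (y : Fin m → ℝ) : ℝ := ∑ i, |y i|

/-- `restr M S T` is the matrix equal to `M` on entries `(i,j)` with `i ∈ S`, `j ∈ T`,
and zero elsewhere. -/
def restr {n : ℕ} (M : Matrix (Fin n) (Fin n) ℝ) (S T : Finset (Fin n)) :
    Matrix (Fin n) (Fin n) ℝ :=
  Matrix.of fun i j => if i ∈ S ∧ j ∈ T then M i j else 0

/-- `Σ_{(s)}^{[r]}`: symmetric matrices of rank at most `r` supported on `S × S` for some
index set `S` of cardinality `s`. -/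
def SigmaRS (n r s : ℕ) : Set (Matrix (Fin n) (Fin n) ℝ) :=
  {M | M.IsSymm ∧ M.rank ≤ r ∧ ∃ S : Finset (Fin n), S.card = s ∧ M = restr M S S}

/-- `Y` is a best rank-`r` Frobenius approximation of `A`. -/
noncomputable def IsBestRankApprox {n : ℕ} (r : ℕ) (A Y : Matrix (Fin n) (Fin n) ℝ) : Prop :=
  Y.rank ≤ r ∧
    ∀ Z : Matrix (Fin n) (Fin n) ℝ, Z.rank ≤ r → frobNorm (A - Y) ≤ frobNorm (A - Z)

lemma frobNorm_restr_sq {n : ℕ} (M : Matrix (Fin n) (Fin n) ℝ) (S T : Finset (Fin n)) :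
    frobNorm (restr M S T) ^ 2 = ∑ j ∈ T, ∑ i ∈ S, M i j ^ 2 := by
  unfold frobNorm restr
  rw [Real.sq_sqrt (by positivity), Finset.sum_comm]
  simp [ite_and, ite_pow, Finset.sum_ite_mem, Finset.sum_ite_irrel]

lemma frobNorm_restr_sq_mono {n : ℕ} (M : Matrix (Fin n) (Fin n) ℝ)
    {S S' T T' : Finset (Fin n)} (hS : S ⊆ S') (hT : T ⊆ T') :
    frobNorm (restr M S T) ^ 2 ≤ frobNorm (restr M S' T') ^ 2 := by
  rw [frobNorm_restr_sq, frobNorm_restr_sq]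
  calc ∑ j ∈ T, ∑ i ∈ S, M i j ^ 2 ≤ ∑ j ∈ T, ∑ i ∈ S', M i j ^ 2 :=
        Finset.sum_le_sum fun j _ =>
          Finset.sum_le_sum_of_subset_of_nonneg hS fun _ _ _ => sq_nonneg _
    _ ≤ ∑ j ∈ T', ∑ i ∈ S', M i j ^ 2 :=
        Finset.sum_le_sum_of_subset_of_nonneg hT fun _ _ _ =>
          Finset.sum_nonneg fun _ _ => sq_nonneg _

/-- If `C` maximizes the sum of `f` among index sets of its cardinality, then the average of `f`
over `C` is at least its average over the whole type. -/
lemma card_mul_sum_le_of_forall_sum_le {ι : Type*} [Fintype ι] [DecidableEq ι] (f : ι → ℝ)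
    (C : Finset ι) (hC : ∀ S : Finset ι, S.card = C.card → ∑ j ∈ S, f j ≤ ∑ j ∈ C, f j) :
    (C.card : ℝ) * ∑ j, f j ≤ Fintype.card ι * ∑ j ∈ C, f j := by
  have exchange : ∀ i ∈ C, ∀ j ∈ Cᶜ, f j ≤ f i := by
    intro i hi j hj
    have hj' : j ∉ C.erase i := fun h => Finset.mem_compl.1 hj (Finset.mem_of_mem_erase h)
    have h := hC (insert j (C.erase i)) (by
      rw [Finset.card_insert_of_notMem hj', Finset.card_erase_add_one hi])
    rw [Finset.sum_insert hj', ← Finset.add_sum_erase C f hi] at h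
    linarith
  have key : ∑ i ∈ C, ∑ j ∈ Cᶜ, f j ≤ ∑ i ∈ C, ∑ _j ∈ Cᶜ, f i :=
    Finset.sum_le_sum fun i hi => Finset.sum_le_sum fun j hj => exchange i hi j hj
  simp only [Finset.sum_const, nsmul_eq_mul, ← Finset.mul_sum] at key
  have hcard : (C.card : ℝ) + Cᶜ.card = Fintype.card ι := by
    exact_mod_cast Finset.card_add_card_compl C
  rw [← Finset.sum_add_sum_compl C f, ← hcard]
  linarith

/-- a head projection for `Σ_(s)` into `Σ_(2s)` with constant `√(s/n)`. -/
theorem stmt9 {n s : ℕ} (hs1 : 1 ≤ s) (hsn : s ≤ n)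
    (M : Matrix (Fin n) (Fin n) ℝ) (hM : M.IsSymm)
    (R : Finset (Fin n)) (hR : R.card = s)
    (hRmax : ∀ S : Finset (Fin n), S.card = s →
      frobNorm (restr M S Finset.univ) ^ 2 ≤ frobNorm (restr M R Finset.univ) ^ 2)
    (C : Finset (Fin n)) (hC : C.card = s)
    (hCmax : ∀ S : Finset (Fin n), S.card = s →
      frobNorm (restr M R S) ^ 2 ≤ frobNorm (restr M R C) ^ 2)
    (T : Finset (Fin n)) (hT : T = R ∪ C) :
    ∀ S : Finset (Fin n), S.card = s →
      frobNorm (restr M T T) ^ 2 ≥ ((s : ℝ) / n) * frobNorm (restr M S S) ^ 2 := by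
  intro S hS
  subst hT
  have hn : (0 : ℝ) < n := by exact_mod_cast hs1.trans hsn
  have hcols : (s : ℝ) * frobNorm (restr M R Finset.univ) ^ 2 ≤
      n * frobNorm (restr M R C) ^ 2 := by
    simp only [frobNorm_restr_sq] at hCmax ⊢
    simpa [hC] using card_mul_sum_le_of_forall_sum_le (fun j => ∑ i ∈ R, M i j ^ 2) C
      fun S hS => hCmax S (hS.trans hC)
  calc (s : ℝ) / n * frobNorm (restr M S S) ^ 2
      ≤ s / n * frobNorm (restr M R Finset.univ) ^ 2 := by
        gcongr ?_ * ?_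
        exact (frobNorm_restr_sq_mono M subset_rfl (Finset.subset_univ S)).trans (hRmax S hS)
    _ ≤ frobNorm (restr M R C) ^ 2 := by
        rw [div_mul_eq_mul_div, div_le_iff₀ hn]
        linarith
    _ ≤ frobNorm (restr M (R ∪ C) (R ∪ C)) ^ 2 :=
        frobNorm_restr_sq_mono M Finset.subset_union_left Finset.subset_union_right
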